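/- Ramanujan identities for Γ₀(2): set 𝒜(τ) = (1/2)(θ₃(τ)⁴ + θ₄(τ)⁴), ℬ(τ) = θ₃(τ)θ₄(τ), 𝒞(τ) = (1/2)θ₂(τ)⁴, and ℰ(τ) = (2E₂(2τ) + E₂(τ))/3. Then for every τ in the complex upper half-plane, (1/2πi)·d𝒜/dτ = (1/4)(𝒜(τ)ℰ(τ) + 𝒞(τ)² − ℬ(τ)⁴), (1/2πi)·dℬ/dτ = (1/8)·ℬ(τ)·(ℰ(τ) − 𝒜(τ)), (1/2πi)·d𝒞/dτ = (1/4)·𝒞(τ)·(ℰ(τ) + 𝒜(τ)), and (1/2πi)·dℰ/dτ = (1/8)(ℰ(τ)² − 𝒜(τ)²). (Here 𝒜 = A₂², ℬ = B₂, 𝒞 = C₂² in the paper's notation for Γ₀(2).) -/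

import Mathlib

noncomputable def theta2 (τ : ℂ) : ℂ :=
  ∑' n : ℤ, Complex.exp (Real.pi * Complex.I * ((n : ℂ) + 1/2)^2 * τ)

noncomputable def theta3 (τ : ℂ) : ℂ :=
  ∑' n : ℤ, Complex.exp (Real.pi * Complex.I * (n : ℂ)^2 * τ)

noncomputable def theta4 (τ : ℂ) : ℂ :=
  ∑' n : ℤ, (-1 : ℂ)^n * Complex.exp (Real.pi * Complex.I * (n : ℂ)^2 * τ)
noncomputable def E2 (τ : ℂ) : ℂ :=
  1 - 24 * ∑' n : ℕ, (∑ d ∈ Nat.divisors (n + 1), (d : ℂ)) *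
    Complex.exp (2 * Real.pi * Complex.I * ((n : ℂ) + 1) * τ)

noncomputable def A2sq (τ : ℂ) : ℂ := (1 / 2) * (theta3 τ ^ 4 + theta4 τ ^ 4)

noncomputable def B2form (τ : ℂ) : ℂ := theta3 τ * theta4 τ

noncomputable def C2sq (τ : ℂ) : ℂ := (1 / 2) * theta2 τ ^ 4

noncomputable def E2quasi (τ : ℂ) : ℂ := (2 * E2 (2 * τ) + E2 τ) / 3

section

open Complex Filter Topology MatrixGroups Manifold ModularForm
open UpperHalfPlane hiding I

/-- A holomorphic function with a limit at `i∞` has derivative tending to zero there. -/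
lemma tendsto_deriv_comap_im_atTop {f : ℂ → ℂ} {L : ℂ}
    (hf : DifferentiableOn ℂ f upperHalfPlaneSet)
    (h : Tendsto f (comap Complex.im atTop) (𝓝 L)) :
    Tendsto (deriv f) (comap Complex.im atTop) (𝓝 0) := by
  rw [Metric.tendsto_nhds] at h ⊢
  intro ε hε
  obtain ⟨t, ht, hts⟩ := h (ε / 2) (half_pos hε)
  obtain ⟨A, hA⟩ := mem_atTop_sets.mp ht
  refine ⟨Set.Ici (max A 1 + 1), Ici_mem_atTop _, fun z hz ↦ ?_⟩
  have him : ∀ w ∈ Metric.closedBall z 1, max A 1 ≤ w.im := by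
    intro w hw
    have h1 := (abs_im_le_norm (w - z)).trans (mem_closedBall_iff_norm.mp hw)
    have h2 := (abs_le.mp h1).1
    have h3 : max A 1 + 1 ≤ z.im := hz
    rw [sub_im] at h2
    linarith
  have hd : DiffContOnCl ℂ (fun w ↦ f w - L) (Metric.ball z 1) := by
    refine DifferentiableOn.diffContOnCl ?_
    rw [closure_ball z one_ne_zero]
    refine (hf.mono fun w hw ↦ ?_).sub_const L
    exact lt_of_lt_of_le one_pos ((le_max_right A 1).trans (him w hw))
  have key := norm_deriv_le_of_forall_mem_sphere_norm_le (C := ε / 2) one_pos hd fun w hw ↦ by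
    have hw' : w ∈ Complex.im ⁻¹' t :=
      hA _ ((le_max_left A 1).trans (him w (Metric.sphere_subset_closedBall hw)))
    exact (dist_eq_norm (f w) L ▸ hts hw' : ‖f w - L‖ < ε / 2).le
  rw [deriv_sub_const] at key
  simp only [Set.mem_ofPred_eq, dist_zero_right]
  linarith

/-- A holomorphic function on the upper half-plane with the transformation behaviour of a
level-one modular form, and vanishing at `i∞`, is a cusp form. -/
lemma exists_cuspForm_eq {f : ℂ → ℂ} (k : ℕ) (hd : DifferentiableOn ℂ f upperHalfPlaneSet)
    (hT : ∀ z : ℂ, 0 < z.im → f (z + 1) = f z)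
    (hS : ∀ z : ℂ, 0 < z.im → f (-1 / z) = z ^ k * f z)
    (hlim : Tendsto f (comap Complex.im atTop) (𝓝 0)) :
    ∃ F : CuspForm 𝒮ℒ k, ∀ z : ℍ, F z = f z := by
  have hT' : (fun z : ℍ ↦ f z) ∣[(k : ℤ)] ModularGroup.T = fun z : ℍ ↦ f z := by
    ext z
    rw [ModularForm.SL_slash_apply, ModularGroup.denom_apply, modular_T_smul]
    simp [ModularGroup.T, add_comm (1 : ℂ), hT z z.2]
  have hS' : (fun z : ℍ ↦ f z) ∣[(k : ℤ)] ModularGroup.S = fun z : ℍ ↦ f z := by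
    ext z
    have hz : (z : ℂ) ^ k ≠ 0 := pow_ne_zero _ z.ne_zero
    suffices f (-(↑z)⁻¹) * ((z : ℂ) ^ k)⁻¹ = f z by
      rw [ModularForm.SL_slash_apply, ModularGroup.denom_S, UpperHalfPlane.modular_S_smul]
      simpa [inv_neg] using this
    have h1 := hS z z.2
    rw [neg_div, one_div] at h1
    rw [h1]
    field_simp
  have hγ := SlashInvariantForm.slash_action_generators_SL2Z hS' hT'
  refine ⟨{ toFun := fun z : ℍ ↦ f z, slash_action_eq' := ?_, holo' := ?_, zero_at_cusps' := ?_ },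
    fun z ↦ rfl⟩
  · rintro _ ⟨A, rfl⟩
    exact hγ A
  · rw [UpperHalfPlane.mdifferentiable_iff]
    refine hd.congr fun z hz ↦ ?_
    simp [ofComplex_apply_of_im_pos hz]
  · intro c hc
    rw [Subgroup.IsArithmetic.isCusp_iff_isCusp_SL2Z] at hc
    rw [OnePoint.isZeroAt_iff_forall_SL2Z hc]
    intro γ _
    rw [hγ]
    exact hlim.comp tendsto_coe_atImInfty

lemma eq_zero_of_modular_of_tendsto_zero {f : ℂ → ℂ} {k : ℕ} (hk : k < 12)
    (hd : DifferentiableOn ℂ f upperHalfPlaneSet)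
    (hT : ∀ z : ℂ, 0 < z.im → f (z + 1) = f z)
    (hS : ∀ z : ℂ, 0 < z.im → f (-1 / z) = z ^ k * f z)
    (hlim : Tendsto f (comap Complex.im atTop) (𝓝 0)) {z : ℂ} (hz : 0 < z.im) : f z = 0 := by
  obtain ⟨F, hF⟩ := exists_cuspForm_eq k hd hT hS hlim
  have h0 : F = 0 := rank_zero_iff_forall_zero.mp
    (CuspForm.rank_eq_zero_of_weight_lt_twelve (k := (k : ℤ)) (by exact_mod_cast hk)) F
  simpa [h0] using (hF ⟨z, hz⟩).symm

/-- Three weight-two functions permuted by the modular group and vanishing at `i∞` are zero: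
their elementary symmetric functions are cusp forms of weight at most `6`. -/
lemma eq_zero_of_permuted_weight_two {a b c : ℂ → ℂ}
    (ha : DifferentiableOn ℂ a upperHalfPlaneSet) (hb : DifferentiableOn ℂ b upperHalfPlaneSet)
    (hc : DifferentiableOn ℂ c upperHalfPlaneSet)
    (haT : ∀ z : ℂ, 0 < z.im → a (z + 1) = a z) (hbT : ∀ z : ℂ, 0 < z.im → b (z + 1) = c z)
    (hcT : ∀ z : ℂ, 0 < z.im → c (z + 1) = b z)
    (haS : ∀ z : ℂ, 0 < z.im → a (-1 / z) = z ^ 2 * c z)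
    (hbS : ∀ z : ℂ, 0 < z.im → b (-1 / z) = z ^ 2 * b z)
    (hcS : ∀ z : ℂ, 0 < z.im → c (-1 / z) = z ^ 2 * a z)
    (hal : Tendsto a (comap Complex.im atTop) (𝓝 0))
    (hbl : Tendsto b (comap Complex.im atTop) (𝓝 0))
    (hcl : Tendsto c (comap Complex.im atTop) (𝓝 0)) {z : ℂ} (hz : 0 < z.im) :
    a z = 0 ∧ b z = 0 ∧ c z = 0 := by
  have h1 : a z + b z + c z = 0 :=
    eq_zero_of_modular_of_tendsto_zero (f := fun z ↦ a z + b z + c z) (k := 2) (by norm_num)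
      ((ha.add hb).add hc)
      (fun z hz ↦ by simp only [haT z hz, hbT z hz, hcT z hz]; ring)
      (fun z hz ↦ by simp only [haS z hz, hbS z hz, hcS z hz]; ring)
      (by simpa using (hal.add hbl).add hcl) hz
  have h2 : a z * b z + b z * c z + c z * a z = 0 :=
    eq_zero_of_modular_of_tendsto_zero (f := fun z ↦ a z * b z + b z * c z + c z * a z) (k := 4)
      (by norm_num) (((ha.mul hb).add (hb.mul hc)).add (hc.mul ha))
      (fun z hz ↦ by simp only [haT z hz, hbT z hz, hcT z hz]; ring)
      (fun z hz ↦ by simp only [haS z hz, hbS z hz, hcS z hz]; ring)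
      (by simpa using ((hal.mul hbl).add (hbl.mul hcl)).add (hcl.mul hal)) hz
  have h3 : a z * b z * c z = 0 :=
    eq_zero_of_modular_of_tendsto_zero (f := fun z ↦ a z * b z * c z) (k := 6) (by norm_num)
      ((ha.mul hb).mul hc)
      (fun z hz ↦ by simp only [haT z hz, hbT z hz, hcT z hz]; ring)
      (fun z hz ↦ by simp only [haS z hz, hbS z hz, hcS z hz]; ring)
      (by simpa using (hal.mul hbl).mul hcl) hz
  refine ⟨?_, ?_, ?_⟩ <;> refine pow_eq_zero_iff (three_ne_zero) |>.mp ?_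
  · linear_combination a z ^ 2 * h1 - a z * h2 + h3
  · linear_combination b z ^ 2 * h1 - b z * h2 + h3
  · linear_combination c z ^ 2 * h1 - c z * h2 + h3

lemma neg_one_div_im_pos {z : ℂ} (hz : 0 < z.im) : 0 < (-1 / z).im := by
  have h := (ModularGroup.S • (⟨z, hz⟩ : ℍ)).2
  rw [UpperHalfPlane.modular_S_smul] at h
  simpa [neg_div, inv_neg] using h

lemma ne_zero_of_im_pos {z : ℂ} (hz : 0 < z.im) : z ≠ 0 := by
  rintro rfl
  simp at hz

lemma hasDerivAt_neg_one_div {z : ℂ} (hz : z ≠ 0) :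
    HasDerivAt (fun w : ℂ ↦ -1 / w) (z ^ 2)⁻¹ z := by
  simpa [neg_div] using (hasDerivAt_inv hz).fun_neg

lemma eventually_im_pos {z : ℂ} (hz : 0 < z.im) : ∀ᶠ w in 𝓝 z, 0 < w.im :=
  isOpen_upperHalfPlaneSet.mem_nhds hz

lemma logDeriv_neg_one_div_of_weight_two {f g : ℂ → ℂ}
    (hf : DifferentiableOn ℂ f upperHalfPlaneSet)
    (hg : DifferentiableOn ℂ g upperHalfPlaneSet) (hg0 : ∀ z : ℂ, 0 < z.im → g z ≠ 0)
    (h : ∀ z : ℂ, 0 < z.im → f (-1 / z) = -z ^ 2 * g z) {z : ℂ} (hz : 0 < z.im) :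
    logDeriv f (-1 / z) = 2 * z + z ^ 2 * logDeriv g z := by
  have hz0 := ne_zero_of_im_pos hz
  have hSz := neg_one_div_im_pos hz
  have hl := ((hf.differentiableAt (isOpen_upperHalfPlaneSet.mem_nhds hSz)).hasDerivAt).comp z
    (hasDerivAt_neg_one_div hz0)
  have hr := ((hasDerivAt_pow 2 z).neg).mul
    (hg.differentiableAt (isOpen_upperHalfPlaneSet.mem_nhds hz)).hasDerivAt
  have he : f ∘ (fun w : ℂ ↦ -1 / w) =ᶠ[𝓝 z] (-fun w : ℂ ↦ w ^ 2) * g :=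
    (eventually_im_pos hz).mono fun w hw ↦ by simp [h w hw]
  have hu := hl.unique (hr.congr_of_eventuallyEq he)
  have hg := hg0 z hz
  rw [logDeriv_apply, logDeriv_apply, h z hz]
  have hu' : deriv f (-1 / z) = z ^ 2 * (-(2 * z) * g z - z ^ 2 * deriv g z) := by
    rw [← div_eq_mul_inv, div_eq_iff (pow_ne_zero 2 hz0)] at hu
    simp only [Pi.neg_apply, Nat.cast_ofNat] at hu
    linear_combination hu
  rw [hu']
  field_simp
  ring

lemma logDeriv_add_one_of_eq_mul {f g : ℂ → ℂ} (c : ℂ) (hc : c ≠ 0)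
    (h : ∀ z : ℂ, f (z + 1) = c * g z) (z : ℂ) : logDeriv f (z + 1) = logDeriv g z := by
  rw [logDeriv_apply, ← deriv_comp_add_const, funext h, h, deriv_const_mul_field,
    mul_div_mul_left _ _ hc, logDeriv_apply]

/-- Exponential series with nonnegative exponents tend to their constant term at `i∞`. -/
lemma tendsto_tsum_mul_exp_comap_im_atTop {ι : Type*} (c : ι → ℂ) (m : ι → ℕ)
    (hs : Summable fun i ↦ ‖c i‖ * Real.exp (-Real.pi * m i)) :
    Tendsto (fun z : ℂ ↦ ∑' i, c i * cexp (Real.pi * I * m i * z)) (comap Complex.im atTop)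
      (𝓝 (∑' i, if m i = 0 then c i else 0)) := by
  have hn : ∀ (i : ι) (z : ℂ), ‖c i * cexp (Real.pi * I * m i * z)‖ =
      ‖c i‖ * Real.exp (-Real.pi * m i * z.im) := by
    intro i z
    rw [norm_mul, norm_exp]
    simp
  refine tendsto_tsum_of_dominated_convergence hs (fun i ↦ ?_) ?_
  · split_ifs with h
    · simpa [h] using tendsto_const_nhds
    · rw [tendsto_zero_iff_norm_tendsto_zero]
      simp_rw [hn]
      have h1 : Tendsto (fun y : ℝ ↦ -Real.pi * m i * y) atTop atBot := by
        refine tendsto_id.const_mul_atTop_of_neg ?_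
        have : 0 < (m i : ℝ) := by exact_mod_cast Nat.pos_of_ne_zero h
        nlinarith [Real.pi_pos]
      simpa using ((Real.tendsto_exp_atBot.comp h1).comp tendsto_comap).const_mul ‖c i‖
  · filter_upwards [tendsto_comap.eventually (eventually_ge_atTop (1 : ℝ))] with z hz i
    rw [hn]
    have : 0 ≤ Real.pi * m i := by positivity
    refine mul_le_mul_of_nonneg_left (Real.exp_le_exp.mpr ?_) (norm_nonneg _)
    have hz' : 1 ≤ z.im := hz
    nlinarith

lemma theta3_eq_jacobiTheta₂ (z : ℂ) : theta3 z = jacobiTheta₂ 0 z :=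
  tsum_congr fun n ↦ by simp [jacobiTheta₂_term]

lemma exp_pi_mul_I_mul_int_sq (n : ℤ) : cexp (Real.pi * I * (n : ℂ) ^ 2) = (-1) ^ n := by
  obtain ⟨k, hk⟩ : Even (n * (n - 1)) := by
    simpa [mul_comm] using Int.even_mul_pred_self n
  have h : (n : ℂ) ^ 2 = n + 2 * k := by
    have : n ^ 2 = n + 2 * k := by linear_combination hk
    exact_mod_cast this
  rw [h, show Real.pi * I * ((n : ℂ) + 2 * k) = n * (Real.pi * I) + k * (2 * Real.pi * I) by ring,
    Complex.exp_add, exp_int_mul_two_pi_mul_I, exp_int_mul, exp_pi_mul_I, mul_one]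

lemma theta4_eq_jacobiTheta₂ (z : ℂ) : theta4 z = jacobiTheta₂ (1 / 2) z :=
  tsum_congr fun n ↦ by
    rw [jacobiTheta₂_term, Complex.exp_add,
      show 2 * Real.pi * I * n * (1 / 2) = (n : ℂ) * (Real.pi * I) by ring, exp_int_mul,
      exp_pi_mul_I]

lemma theta2_eq_jacobiTheta₂ (z : ℂ) :
    theta2 z = cexp (Real.pi * I / 4 * z) * jacobiTheta₂ (z / 2) z := by
  rw [jacobiTheta₂, ← tsum_mul_left]
  refine tsum_congr fun n ↦ ?_
  rw [jacobiTheta₂_term, ← Complex.exp_add]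
  ring_nf

lemma theta3_add_one (z : ℂ) : theta3 (z + 1) = theta4 z :=
  tsum_congr fun n ↦ by
    rw [mul_add, Complex.exp_add, mul_one, exp_pi_mul_I_mul_int_sq, mul_comm]

lemma theta4_add_one (z : ℂ) : theta4 (z + 1) = theta3 z :=
  tsum_congr fun n ↦ by
    rw [mul_add, Complex.exp_add, mul_one, exp_pi_mul_I_mul_int_sq, mul_left_comm, ← mul_zpow]
    simp

lemma theta2_add_one (z : ℂ) : theta2 (z + 1) = cexp (Real.pi * I / 4) * theta2 z := by
  rw [theta2, theta2, ← tsum_mul_left]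
  refine tsum_congr fun n ↦ ?_
  obtain ⟨k, hk⟩ := Int.even_mul_succ_self n
  have h : ((n : ℂ) + 1 / 2) ^ 2 = 2 * k + 1 / 4 := by
    have : (n : ℂ) * (n + 1) = k + k := by exact_mod_cast hk
    linear_combination this
  rw [mul_add, Complex.exp_add, mul_comm, mul_one]
  congr 1
  rw [h, show Real.pi * I * (2 * (k : ℂ) + 1 / 4) =
    k * (2 * Real.pi * I) + Real.pi * I / 4 by ring, Complex.exp_add, exp_int_mul_two_pi_mul_I,
    one_mul]

lemma theta2_pow_four_add_one (z : ℂ) : theta2 (z + 1) ^ 4 = -theta2 z ^ 4 := by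
  rw [theta2_add_one, mul_pow, ← Complex.exp_nat_mul,
    show ((4 : ℕ) : ℂ) * (Real.pi * I / 4) = Real.pi * I by push_cast; ring, exp_pi_mul_I]
  ring

lemma neg_I_mul_cpow_half_pow_four (z : ℂ) : ((-I * z) ^ (1 / 2 : ℂ)) ^ 4 = -z ^ 2 := by
  rw [← cpow_nat_mul, show ((4 : ℕ) : ℂ) * (1 / 2) = (2 : ℕ) by norm_num, cpow_natCast, mul_pow,
    neg_sq, I_sq]
  ring

lemma neg_I_mul_cpow_half_ne_zero {z : ℂ} (hz : z ≠ 0) : (-I * z) ^ (1 / 2 : ℂ) ≠ 0 := by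
  simp [cpow_eq_zero_iff, hz]

lemma theta3_pow_four_neg_one_div {z : ℂ} (hz : 0 < z.im) :
    theta3 (-1 / z) ^ 4 = -z ^ 2 * theta3 z ^ 4 := by
  have h0 := neg_I_mul_cpow_half_ne_zero (ne_zero_of_im_pos hz)
  have h := jacobiTheta₂_functional_equation 0 z
  simp only [zero_div, ne_eq, OfNat.ofNat_ne_zero, not_false_eq_true, zero_pow, mul_zero,
    Complex.exp_zero, mul_one] at h
  rw [theta3_eq_jacobiTheta₂, theta3_eq_jacobiTheta₂, h, ← neg_I_mul_cpow_half_pow_four, mul_pow,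
    ← mul_assoc, ← mul_pow, mul_one_div_cancel h0, one_pow, one_mul]

lemma theta4_pow_four_neg_one_div {z : ℂ} (hz : 0 < z.im) :
    theta4 (-1 / z) ^ 4 = -z ^ 2 * theta2 z ^ 4 := by
  have hz0 := ne_zero_of_im_pos hz
  have h0 := neg_I_mul_cpow_half_ne_zero hz0
  have h := jacobiTheta₂_functional_equation (z / 2) z
  rw [show z / 2 / z = 1 / 2 by field_simp,
    show -Real.pi * I * (z / 2) ^ 2 / z = -(Real.pi * I / 4 * z) by field_simp; ring,
    Complex.exp_neg] at h
  have he := Complex.exp_ne_zero (Real.pi * I / 4 * z)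
  rw [theta4_eq_jacobiTheta₂, theta2_eq_jacobiTheta₂, h, ← neg_I_mul_cpow_half_pow_four]
  field_simp

lemma theta2_pow_four_neg_one_div {z : ℂ} (hz : 0 < z.im) :
    theta2 (-1 / z) ^ 4 = -z ^ 2 * theta4 z ^ 4 := by
  have hz0 := ne_zero_of_im_pos hz
  have h := theta4_pow_four_neg_one_div (neg_one_div_im_pos hz)
  rw [show -1 / (-1 / z) = z by field_simp] at h
  rw [h]
  field_simp

lemma differentiableOn_theta3 : DifferentiableOn ℂ theta3 upperHalfPlaneSet := by
  rw [funext theta3_eq_jacobiTheta₂]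
  exact fun z hz ↦ (differentiableAt_jacobiTheta₂_snd 0 hz).differentiableWithinAt

lemma differentiableOn_theta4 : DifferentiableOn ℂ theta4 upperHalfPlaneSet := by
  rw [funext theta4_eq_jacobiTheta₂]
  exact fun z hz ↦ (differentiableAt_jacobiTheta₂_snd (1 / 2) hz).differentiableWithinAt

lemma differentiableOn_jacobiTheta₂_half_self :
    DifferentiableOn ℂ (fun z ↦ jacobiTheta₂ (z / 2) z) upperHalfPlaneSet := by
  intro z hz
  have h := (hasFDerivAt_jacobiTheta₂ (z / 2) hz).differentiableAt
  exact (DifferentiableAt.comp (f := fun w : ℂ ↦ (w / 2, w)) z h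
    (by fun_prop)).differentiableWithinAt

lemma differentiableOn_theta2 : DifferentiableOn ℂ theta2 upperHalfPlaneSet := by
  rw [funext theta2_eq_jacobiTheta₂]
  exact DifferentiableOn.mul (by fun_prop) differentiableOn_jacobiTheta₂_half_self

lemma summable_exp_neg_pi_mul_int_sq :
    Summable fun n : ℤ ↦ Real.exp (-Real.pi * ((n ^ 2).natAbs : ℕ)) := by
  have h := ((summable_jacobiTheta₂_term_iff 0 I).mpr (by simp)).norm
  refine h.congr fun n ↦ ?_
  rw [norm_jacobiTheta₂_term, Nat.cast_natAbs]
  simp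

lemma natCast_natAbs_of_nonneg {m : ℤ} (hm : 0 ≤ m) : ((m.natAbs : ℕ) : ℂ) = m := by
  rw [← Int.cast_natCast, Int.natAbs_of_nonneg hm]

lemma tendsto_theta3 : Tendsto theta3 (comap Complex.im atTop) (𝓝 1) := by
  have h := tendsto_tsum_mul_exp_comap_im_atTop (fun _ : ℤ ↦ (1 : ℂ)) (fun n ↦ (n ^ 2).natAbs)
    (by simpa using summable_exp_neg_pi_mul_int_sq)
  have h1 : ∑' n : ℤ, (if (n ^ 2).natAbs = 0 then (1 : ℂ) else 0) = 1 := by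
    simp
  rw [h1] at h
  refine h.congr fun z ↦ tsum_congr fun n ↦ ?_
  rw [natCast_natAbs_of_nonneg (sq_nonneg n), one_mul]
  push_cast
  rfl

lemma tendsto_add_one_comap_im_atTop :
    Tendsto (fun z : ℂ ↦ z + 1) (comap Complex.im atTop) (comap Complex.im atTop) := by
  rw [tendsto_comap_iff]
  exact tendsto_comap.congr fun z ↦ by simp

lemma tendsto_theta4 : Tendsto theta4 (comap Complex.im atTop) (𝓝 1) :=
  (tendsto_theta3.comp tendsto_add_one_comap_im_atTop).congr fun z ↦ theta3_add_one z

lemma tendsto_jacobiTheta₂_half_self :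
    Tendsto (fun z ↦ jacobiTheta₂ (z / 2) z) (comap Complex.im atTop) (𝓝 2) := by
  have hnn : ∀ n : ℤ, 0 ≤ n ^ 2 + n := fun n ↦ by
    rcases le_or_gt 0 n with h | h <;> nlinarith
  have hs := ((summable_jacobiTheta₂_term_iff (I / 2) I).mpr (by simp)).norm
  have h := tendsto_tsum_mul_exp_comap_im_atTop (fun _ : ℤ ↦ (1 : ℂ))
    (fun n ↦ (n ^ 2 + n).natAbs) (by
      refine hs.congr fun n ↦ ?_
      rw [norm_jacobiTheta₂_term, Nat.cast_natAbs, abs_of_nonneg (hnn n)]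
      simp
      ring)
  have h1 : ∑' n : ℤ, (if (n ^ 2 + n).natAbs = 0 then (1 : ℂ) else 0) = 2 := by
    rw [tsum_eq_sum (s := {0, -1})]
    · rw [Finset.sum_pair (by norm_num)]
      norm_num
    · intro n hn
      simp only [Finset.mem_insert, Finset.mem_singleton, not_or] at hn
      rw [if_neg]
      intro h0
      have h2 : n * (n + 1) = 0 := by
        linear_combination Int.natAbs_eq_zero.mp h0
      rcases mul_eq_zero.mp h2 with h3 | h3
      · exact hn.1 h3
      · exact hn.2 (by linarith)
  rw [h1] at h
  refine h.congr fun z ↦ tsum_congr fun n ↦ ?_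
  rw [natCast_natAbs_of_nonneg (hnn n), one_mul, jacobiTheta₂_term]
  push_cast
  ring_nf

lemma tendsto_exp_pi_mul_I_mul :
    Tendsto (fun z ↦ cexp (Real.pi * I * z)) (comap Complex.im atTop) (𝓝 0) := by
  simpa using tendsto_tsum_mul_exp_comap_im_atTop (fun _ : Unit ↦ (1 : ℂ)) (fun _ ↦ 1)
    (Summable.of_finite)

lemma theta2_pow_four_eq (z : ℂ) :
    theta2 z ^ 4 = cexp (Real.pi * I * z) * jacobiTheta₂ (z / 2) z ^ 4 := by
  rw [theta2_eq_jacobiTheta₂, mul_pow, ← Complex.exp_nat_mul]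
  push_cast
  ring_nf

lemma tendsto_theta2_pow_four :
    Tendsto (fun z ↦ theta2 z ^ 4) (comap Complex.im atTop) (𝓝 0) := by
  have h := tendsto_exp_pi_mul_I_mul.mul (tendsto_jacobiTheta₂_half_self.pow 4)
  rw [zero_mul] at h
  exact h.congr fun z ↦ (theta2_pow_four_eq z).symm

instance neBot_comap_im_atTop : NeBot (comap Complex.im atTop) :=
  NeBot.of_map (m := id) <| tendsto_coe_atImInfty.neBot

/-- The theta constants have no zeros: up to a constant, `(θ₂θ₃θ₄) ^ 8` is the discriminant. -/
lemma theta_mul_ne_zero {z : ℂ} (hz : 0 < z.im) : theta2 z * theta3 z * theta4 z ≠ 0 := by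
  obtain ⟨F, hF⟩ := exists_cuspForm_eq
    (f := fun z ↦ (theta2 z ^ 4 * theta3 z ^ 4 * theta4 z ^ 4) ^ 2) 12
    ((((differentiableOn_theta2.pow 4).mul (differentiableOn_theta3.pow 4)).mul
      (differentiableOn_theta4.pow 4)).pow 2)
    (fun z _ ↦ by
      simp only [theta2_pow_four_add_one, theta3_add_one, theta4_add_one]
      ring)
    (fun z hz ↦ by
      simp only [theta2_pow_four_neg_one_div hz, theta3_pow_four_neg_one_div hz,
        theta4_pow_four_neg_one_div hz]
      ring)
    (by simpa using
      ((tendsto_theta2_pow_four.mul (tendsto_theta3.pow 4)).mul (tendsto_theta4.pow 4)).pow 2)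
  obtain ⟨c, hc⟩ := CuspForm.exists_smul_discriminant_of_weight_eq_twelve F
  have key (w : ℂ) (hw : 0 < w.im) : (theta2 w ^ 4 * theta3 w ^ 4 * theta4 w ^ 4) ^ 2 =
      c * ModularForm.discriminant ⟨w, hw⟩ := by
    rw [← hF ⟨w, hw⟩, ← hc]
    rfl
  obtain ⟨w, hw, h2, h3, h4⟩ := ((tendsto_comap.eventually (eventually_gt_atTop (0 : ℝ))).and
    ((tendsto_jacobiTheta₂_half_self.eventually_ne two_ne_zero).and
    ((tendsto_theta3.eventually_ne one_ne_zero).and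
    (tendsto_theta4.eventually_ne one_ne_zero)))).exists
  have hc0 : c ≠ 0 := by
    rintro rfl
    have h := key w hw
    rw [theta2_pow_four_eq] at h
    simp [h2, h3, h4] at h
  intro h0
  have h := key z hz
  rw [← mul_pow, ← mul_pow, h0] at h
  exact mul_ne_zero hc0 (ModularForm.discriminant_ne_zero ⟨z, hz⟩) (by simpa using h.symm)


lemma E2_eq_eisensteinSeries_E2 {z : ℂ} (hz : 0 < z.im) :
    E2 z = EisensteinSeries.E2 ⟨z, hz⟩ := by
  rw [EisensteinSeries.E2_eq_tsum_cexp, E2,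
    tsum_pnat_eq_tsum_succ (f := fun n : ℕ ↦ (ArithmeticFunction.sigma 1 n : ℂ) *
      cexp (2 * Real.pi * I * z) ^ n)]
  congr 2
  refine tsum_congr fun n ↦ ?_
  rw [ArithmeticFunction.sigma_one_apply, ← Complex.exp_nat_mul]
  push_cast
  ring_nf

lemma differentiableOn_E2 : DifferentiableOn ℂ E2 upperHalfPlaneSet := by
  refine (UpperHalfPlane.mdifferentiable_iff.mp E2_mdifferentiable).congr
    fun z hz ↦ ?_
  simp [ofComplex_apply_of_im_pos hz, E2_eq_eisensteinSeries_E2 hz]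

lemma E2_add_one (z : ℂ) : E2 (z + 1) = E2 z := by
  rw [E2, E2]
  congr 2
  refine tsum_congr fun n ↦ ?_
  rw [show 2 * Real.pi * I * ((n : ℂ) + 1) * (z + 1) =
    2 * Real.pi * I * ((n : ℂ) + 1) * z + (n + 1 : ℕ) * (2 * Real.pi * I) by push_cast; ring,
    Complex.exp_add, exp_nat_mul_two_pi_mul_I, mul_one]

lemma E2_neg_one_div {z : ℂ} (hz : 0 < z.im) :
    E2 (-1 / z) = z ^ 2 * E2 z + 6 * z / (Real.pi * I) := by
  have hz0 := ne_zero_of_im_pos hz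
  have hpi : (Real.pi : ℂ) ≠ 0 := by exact_mod_cast Real.pi_ne_zero
  have h := congrFun (EisensteinSeries.E2_slash_action ModularGroup.S) ⟨z, hz⟩
  rw [ModularForm.SL_slash_apply, ModularGroup.denom_S, UpperHalfPlane.modular_S_smul,
    Pi.sub_apply, Pi.smul_apply, EisensteinSeries.D2_S, riemannZeta_two,
    ← E2_eq_eisensteinSeries_E2, ← E2_eq_eisensteinSeries_E2] at h
  simp only [Int.reduceNeg, zpow_neg, smul_eq_mul, inv_neg] at h
  rw [neg_div, one_div]
  have h2 : ((z ^ (2 : ℤ))⁻¹ : ℂ) * z ^ 2 = 1 := by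
    rw [zpow_ofNat, inv_mul_cancel₀ (pow_ne_zero 2 hz0)]
  have h3 : E2 (-z⁻¹) = z ^ 2 * (E2 (-z⁻¹) * (z ^ (2 : ℤ))⁻¹) := by
    linear_combination (-E2 (-z⁻¹)) * h2
  rw [h3, h]
  field_simp
  linear_combination (-6 : ℂ) * I_sq

lemma tendsto_E2 : Tendsto E2 (comap Complex.im atTop) (𝓝 1) := by
  have hs := (summable_nat_add_iff 1).mpr
    (EisensteinSeries.summable_sigma_mul_cexp_pow (k := 2) one_le_two UpperHalfPlane.I).norm
  have h := tendsto_tsum_mul_exp_comap_im_atTop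
    (fun n : ℕ ↦ ∑ d ∈ Nat.divisors (n + 1), (d : ℂ)) (fun n ↦ 2 * (n + 1)) (by
      refine hs.congr fun n ↦ ?_
      rw [norm_mul, ← Complex.exp_nat_mul, norm_exp, Nat.add_one_sub_one,
        ArithmeticFunction.sigma_one_apply]
      congr 2
      · push_cast
        rfl
      · simp
        ring)
  have h' := (h.const_mul 24).const_sub 1
  simp only [mul_eq_zero, OfNat.ofNat_ne_zero, Nat.add_eq_zero_iff, one_ne_zero, and_false,
    or_self, if_false, tsum_zero, mul_zero, sub_zero] at h'
  refine h'.congr fun z ↦ ?_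
  rw [E2]
  congr 2
  refine tsum_congr fun n ↦ ?_
  push_cast
  ring_nf

lemma deriv_E2_add_one (z : ℂ) : deriv E2 (z + 1) = deriv E2 z := by
  rw [← deriv_comp_add_const, funext E2_add_one]

lemma deriv_E2_neg_one_div {z : ℂ} (hz : 0 < z.im) :
    deriv E2 (-1 / z) = z ^ 2 * (2 * z * E2 z + z ^ 2 * deriv E2 z + 6 / (Real.pi * I)) := by
  have hz0 := ne_zero_of_im_pos hz
  have hl := ((differentiableOn_E2.differentiableAt (isOpen_upperHalfPlaneSet.mem_nhds
    (neg_one_div_im_pos hz))).hasDerivAt).comp z (hasDerivAt_neg_one_div hz0)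
  have hr := ((hasDerivAt_pow 2 z).mul (differentiableOn_E2.differentiableAt
    (isOpen_upperHalfPlaneSet.mem_nhds hz)).hasDerivAt).add
    (((hasDerivAt_id z).const_mul 6).div_const (Real.pi * I))
  have he : E2 ∘ (fun w : ℂ ↦ -1 / w) =ᶠ[𝓝 z]
      ((fun w : ℂ ↦ w ^ 2) * E2 + fun w : ℂ ↦ 6 * id w / (Real.pi * I)) :=
    (eventually_im_pos hz).mono fun w hw ↦ by simp [E2_neg_one_div hw]
  have hu := hl.unique (hr.congr_of_eventuallyEq he)
  rw [← div_eq_mul_inv, div_eq_iff (pow_ne_zero 2 hz0)] at hu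
  simp only [Nat.cast_ofNat] at hu
  linear_combination hu

/-- Jacobi's quartic identity. -/
lemma theta3_pow_four_eq {z : ℂ} (hz : 0 < z.im) :
    theta3 z ^ 4 = theta2 z ^ 4 + theta4 z ^ 4 := by
  have h : (theta3 z ^ 4 - theta2 z ^ 4 - theta4 z ^ 4) ^ 2 = 0 :=
    eq_zero_of_modular_of_tendsto_zero
      (f := fun z ↦ (theta3 z ^ 4 - theta2 z ^ 4 - theta4 z ^ 4) ^ 2) (k := 4) (by norm_num)
      ((((differentiableOn_theta3.pow 4).sub (differentiableOn_theta2.pow 4)).sub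
        (differentiableOn_theta4.pow 4)).pow 2)
      (fun z _ ↦ by
        simp only [theta2_pow_four_add_one, theta3_add_one, theta4_add_one]
        ring)
      (fun z hz ↦ by
        simp only [theta2_pow_four_neg_one_div hz, theta3_pow_four_neg_one_div hz,
          theta4_pow_four_neg_one_div hz]
        ring)
      (by simpa using
        (((tendsto_theta3.pow 4).sub tendsto_theta2_pow_four).sub (tendsto_theta4.pow 4)).pow 2) hz
  linear_combination pow_eq_zero_iff (two_ne_zero) |>.mp h

/-- Ramanujan's identity for the derivative of `E2`, with `E4` written in theta constants. -/
lemma deriv_E2_eq {z : ℂ} (hz : 0 < z.im) :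
    6 / (Real.pi * I) * deriv E2 z =
      E2 z ^ 2 - (theta2 z ^ 8 + theta3 z ^ 8 + theta4 z ^ 8) / 2 := by
  have hl : Tendsto (fun z ↦ E2 z ^ 2 - 6 / (Real.pi * I) * deriv E2 z -
      ((theta2 z ^ 4) ^ 2 + (theta3 z ^ 4) ^ 2 + (theta4 z ^ 4) ^ 2) / 2)
      (comap Complex.im atTop) (𝓝 0) := by
    have h := ((tendsto_E2.pow 2).sub ((tendsto_deriv_comap_im_atTop differentiableOn_E2
      tendsto_E2).const_mul (6 / (Real.pi * I)))).sub ((((tendsto_theta2_pow_four.pow 2).add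
      ((tendsto_theta3.pow 4).pow 2)).add ((tendsto_theta4.pow 4).pow 2)).div_const 2)
    norm_num at h
    exact h
  have hd := ((differentiableOn_E2.pow 2).sub ((differentiableOn_E2.deriv
    isOpen_upperHalfPlaneSet).const_mul (6 / (Real.pi * I)))).sub
    (((((differentiableOn_theta2.pow 4).pow 2).add ((differentiableOn_theta3.pow 4).pow 2)).add
    ((differentiableOn_theta4.pow 4).pow 2)).div_const 2)
  have h := eq_zero_of_modular_of_tendsto_zero (k := 4) (by norm_num) hd
    (fun z _ ↦ by
      simp only [Pi.sub_apply, Pi.add_apply, Pi.pow_apply, theta2_pow_four_add_one,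
        theta3_add_one, theta4_add_one, E2_add_one, deriv_E2_add_one]
      ring)
    (fun z hz ↦ by
      simp only [Pi.sub_apply, Pi.add_apply, Pi.pow_apply, theta2_pow_four_neg_one_div hz,
        theta3_pow_four_neg_one_div hz, theta4_pow_four_neg_one_div hz, E2_neg_one_div hz,
        deriv_E2_neg_one_div hz]
      ring) hl hz
  simp only [Pi.sub_apply, Pi.add_apply, Pi.pow_apply] at h
  linear_combination -h

lemma tendsto_ofReal_mul_comap_im_atTop {r : ℝ} (hr : 0 < r) :
    Tendsto (fun z : ℂ ↦ (r : ℂ) * z) (comap Complex.im atTop) (comap Complex.im atTop) := by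
  rw [tendsto_comap_iff]
  exact (tendsto_comap.const_mul_atTop hr).congr fun z ↦ by simp

lemma tendsto_E2_two_mul : Tendsto (fun z ↦ E2 (2 * z)) (comap Complex.im atTop) (𝓝 1) := by
  simpa using! tendsto_E2.comp (tendsto_ofReal_mul_comap_im_atTop two_pos)

lemma tendsto_E2_div_two : Tendsto (fun z ↦ E2 (z / 2)) (comap Complex.im atTop) (𝓝 1) :=
  (tendsto_E2.comp (tendsto_ofReal_mul_comap_im_atTop one_half_pos)).congr fun z ↦ by
    rw [Function.comp_apply]
    push_cast
    ring_nf

lemma E2_add_one_div_two_neg_one_div {z : ℂ} (hz : 0 < z.im) :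
    E2 ((-1 / z + 1) / 2) = z ^ 2 * E2 ((z + 1) / 2) + 12 * z / (Real.pi * I) := by
  have hy : 0 < ((z - 1) / 2).im := by
    rw [show (z - 1) / 2 = ((1 / 2 : ℝ) : ℂ) * (z - 1) by push_cast; ring, im_ofReal_mul]
    simpa using hz
  have hy0 : z - 1 ≠ 0 := fun h ↦ by simp [h] at hy
  have hz0 := ne_zero_of_im_pos hz
  set x := -1 / ((z - 1) / 2) - 2 with hx
  have hxz : x = -2 * z / (z - 1) := by
    rw [hx]
    field_simp
    ring
  have hx0 : 0 < x.im := by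
    simpa [hx] using neg_one_div_im_pos hy
  have h1 := E2_neg_one_div hx0
  have h2 : E2 x = E2 (-1 / ((z - 1) / 2)) := by
    rw [← E2_add_one x, ← E2_add_one (x + 1)]
    congr 1
    rw [hx]
    ring
  have h3 : E2 ((z + 1) / 2) = E2 ((z - 1) / 2) := by
    rw [← E2_add_one ((z - 1) / 2)]
    ring_nf
  have h4 : (-1 / z + 1) / 2 = -1 / x := by
    rw [hxz]
    field_simp
    ring
  rw [h4, h1, h2, E2_neg_one_div hy, h3, hxz]
  have hpi : (Real.pi : ℂ) ≠ 0 := by exact_mod_cast Real.pi_ne_zero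
  field_simp
  ring

lemma E2_two_mul_neg_one_div {z : ℂ} (hz : 0 < z.im) :
    E2 (2 * (-1 / z)) = z ^ 2 / 4 * E2 (z / 2) + 3 * z / (Real.pi * I) := by
  have hy : 0 < (z / 2).im := by
    simpa [div_eq_mul_inv, mul_comm] using hz
  rw [show 2 * (-1 / z) = -1 / (z / 2) by field_simp, E2_neg_one_div hy]
  ring

lemma E2_div_two_neg_one_div {z : ℂ} (hz : 0 < z.im) :
    E2 (-1 / z / 2) = 4 * z ^ 2 * E2 (2 * z) + 12 * z / (Real.pi * I) := by
  have hy : 0 < (2 * z).im := by simpa using hz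
  rw [show -1 / z / 2 = -1 / (2 * z) by rw [div_div, mul_comm], E2_neg_one_div hy]
  ring

lemma E2_two_mul_eq {z : ℂ} (hz : 0 < z.im) :
    2 * E2 (2 * z) = E2 z + (theta3 z ^ 4 + theta4 z ^ 4) / 2 := by
  have hcomp : ∀ g : ℂ → ℂ, Differentiable ℂ g → (∀ z : ℂ, 0 < z.im → 0 < (g z).im) →
      DifferentiableOn ℂ (fun z ↦ E2 (g z)) upperHalfPlaneSet := fun g hg hg' ↦
    differentiableOn_E2.comp hg.differentiableOn hg'
  have d1 := hcomp (fun z ↦ 2 * z) (by fun_prop) (fun z hz ↦ by simpa using hz)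
  have d2 := hcomp (fun z ↦ z / 2) (by fun_prop) (fun z hz ↦ by
    simpa [div_eq_mul_inv, mul_comm] using hz)
  have d3 := hcomp (fun z ↦ (z + 1) / 2) (by fun_prop) (fun z hz ↦ by
    simpa [div_eq_mul_inv, mul_comm] using hz)
  have t3 : Tendsto (fun z ↦ E2 ((z + 1) / 2)) (comap Complex.im atTop) (𝓝 1) :=
    tendsto_E2_div_two.comp tendsto_add_one_comap_im_atTop
  have F2 := differentiableOn_theta2.fun_pow 4
  have F3 := differentiableOn_theta3.fun_pow 4
  have F4 := differentiableOn_theta4.fun_pow 4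
  have h := eq_zero_of_permuted_weight_two
    (a := fun z ↦ 2 * E2 (2 * z) - E2 z - (theta3 z ^ 4 + theta4 z ^ 4) / 2)
    (b := fun z ↦ E2 ((z + 1) / 2) / 2 - E2 z + (theta4 z ^ 4 - theta2 z ^ 4) / 2)
    (c := fun z ↦ E2 (z / 2) / 2 - E2 z + (theta3 z ^ 4 + theta2 z ^ 4) / 2)
    (((d1.const_mul 2).sub differentiableOn_E2).sub ((F3.add F4).div_const 2))
    (((d3.div_const 2).sub differentiableOn_E2).add ((F4.sub F2).div_const 2))
    (((d2.div_const 2).sub differentiableOn_E2).add ((F3.add F2).div_const 2))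
    (fun z _ ↦ by
      simp only [theta3_add_one, theta4_add_one, E2_add_one]
      rw [show 2 * (z + 1) = 2 * z + 1 + 1 by ring, E2_add_one, E2_add_one]
      ring)
    (fun z _ ↦ by
      simp only [theta2_pow_four_add_one, theta4_add_one, E2_add_one]
      rw [show (z + 1 + 1) / 2 = z / 2 + 1 by ring, E2_add_one]
      ring)
    (fun z _ ↦ by
      simp only [theta2_pow_four_add_one, theta3_add_one, E2_add_one]
      ring)
    (fun z hz ↦ by
      simp only [theta3_pow_four_neg_one_div hz, theta4_pow_four_neg_one_div hz,
        E2_neg_one_div hz, E2_two_mul_neg_one_div hz]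
      ring)
    (fun z hz ↦ by
      simp only [theta2_pow_four_neg_one_div hz, theta4_pow_four_neg_one_div hz,
        E2_neg_one_div hz, E2_add_one_div_two_neg_one_div hz]
      ring)
    (fun z hz ↦ by
      simp only [theta3_pow_four_neg_one_div hz, theta2_pow_four_neg_one_div hz,
        E2_neg_one_div hz, E2_div_two_neg_one_div hz]
      ring)
    (by
      have := ((tendsto_E2_two_mul.const_mul 2).sub tendsto_E2).sub
        (((tendsto_theta3.pow 4).add (tendsto_theta4.pow 4)).div_const 2)
      norm_num at this
      exact this)
    (by
      have := ((t3.div_const 2).sub tendsto_E2).add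
        (((tendsto_theta4.pow 4).sub tendsto_theta2_pow_four).div_const 2)
      norm_num at this
      exact this)
    (by
      have := ((tendsto_E2_div_two.div_const 2).sub tendsto_E2).add
        (((tendsto_theta3.pow 4).add tendsto_theta2_pow_four).div_const 2)
      norm_num at this
      exact this) hz
  linear_combination h.1

lemma tendsto_logDeriv_comap_im_atTop {f : ℂ → ℂ} {L : ℂ} (hL : L ≠ 0)
    (hf : DifferentiableOn ℂ f upperHalfPlaneSet)
    (h : Tendsto f (comap Complex.im atTop) (𝓝 L)) :
    Tendsto (logDeriv f) (comap Complex.im atTop) (𝓝 0) := by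
  have h' := (tendsto_deriv_comap_im_atTop hf h).div h hL
  rwa [zero_div] at h'

lemma theta2_ne_zero {z : ℂ} (hz : 0 < z.im) : theta2 z ≠ 0 :=
  left_ne_zero_of_mul (left_ne_zero_of_mul (theta_mul_ne_zero hz))

lemma theta3_ne_zero {z : ℂ} (hz : 0 < z.im) : theta3 z ≠ 0 :=
  right_ne_zero_of_mul (left_ne_zero_of_mul (theta_mul_ne_zero hz))

lemma theta4_ne_zero {z : ℂ} (hz : 0 < z.im) : theta4 z ≠ 0 :=
  right_ne_zero_of_mul (theta_mul_ne_zero hz)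

lemma tendsto_logDeriv_theta2_pow_four :
    Tendsto (logDeriv fun z ↦ theta2 z ^ 4) (comap Complex.im atTop) (𝓝 (Real.pi * I)) := by
  have hd := differentiableOn_jacobiTheta₂_half_self.fun_pow 4
  have h := (tendsto_logDeriv_comap_im_atTop (by norm_num) hd
    (tendsto_jacobiTheta₂_half_self.pow 4)).const_add (Real.pi * I)
  rw [add_zero] at h
  refine h.congr' ?_
  filter_upwards [tendsto_comap.eventually (eventually_gt_atTop (0 : ℝ))] with z hz
  have hne := pow_ne_zero 4 (theta2_ne_zero hz)
  rw [theta2_pow_four_eq] at hne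
  rw [funext theta2_pow_four_eq,
    logDeriv_mul (f := fun z ↦ cexp (Real.pi * I * z)) z (Complex.exp_ne_zero _)
      (right_ne_zero_of_mul hne) (by fun_prop)
      (hd.differentiableAt (isOpen_upperHalfPlaneSet.mem_nhds hz))]
  congr 1
  have he : HasDerivAt (fun z ↦ cexp (Real.pi * I * z))
      (cexp (Real.pi * I * z) * (Real.pi * I * 1)) z :=
    ((hasDerivAt_id z).const_mul (Real.pi * I)).cexp
  rw [logDeriv_apply, he.deriv, mul_one, mul_div_cancel_left₀ _ (Complex.exp_ne_zero _)]

/-- Logarithmic derivatives of the fourth powers of the theta constants. -/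
lemma logDeriv_theta_pow_four {z : ℂ} (hz : 0 < z.im) :
    3 / (Real.pi * I) * logDeriv (fun z ↦ theta2 z ^ 4) z =
      E2 z + theta3 z ^ 4 + theta4 z ^ 4 ∧
    3 / (Real.pi * I) * logDeriv (fun z ↦ theta3 z ^ 4) z =
      E2 z + theta2 z ^ 4 - theta4 z ^ 4 ∧
    3 / (Real.pi * I) * logDeriv (fun z ↦ theta4 z ^ 4) z =
      E2 z - theta2 z ^ 4 - theta3 z ^ 4 := by
  have hpi : (Real.pi : ℂ) ≠ 0 := by exact_mod_cast Real.pi_ne_zero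
  have F2 := differentiableOn_theta2.fun_pow 4
  have F3 := differentiableOn_theta3.fun_pow 4
  have F4 := differentiableOn_theta4.fun_pow 4
  have N2 := fun z hz ↦ pow_ne_zero 4 (theta2_ne_zero (z := z) hz)
  have N3 := fun z hz ↦ pow_ne_zero 4 (theta3_ne_zero (z := z) hz)
  have N4 := fun z hz ↦ pow_ne_zero 4 (theta4_ne_zero (z := z) hz)
  have hL : ∀ {f : ℂ → ℂ}, DifferentiableOn ℂ f upperHalfPlaneSet →
      (∀ z : ℂ, 0 < z.im → f z ≠ 0) →
      DifferentiableOn ℂ (fun z ↦ 3 / (Real.pi * I) * logDeriv f z) upperHalfPlaneSet :=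
    fun hf hf0 ↦ ((hf.deriv isOpen_upperHalfPlaneSet).div hf hf0).const_mul _
  have h := eq_zero_of_permuted_weight_two
    (a := fun z ↦ 3 / (Real.pi * I) * logDeriv (fun z ↦ theta2 z ^ 4) z -
      (E2 z + theta3 z ^ 4 + theta4 z ^ 4))
    (b := fun z ↦ 3 / (Real.pi * I) * logDeriv (fun z ↦ theta3 z ^ 4) z -
      (E2 z + theta2 z ^ 4 - theta4 z ^ 4))
    (c := fun z ↦ 3 / (Real.pi * I) * logDeriv (fun z ↦ theta4 z ^ 4) z -
      (E2 z - theta2 z ^ 4 - theta3 z ^ 4))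
    ((hL F2 N2).sub ((differentiableOn_E2.add F3).add F4))
    ((hL F3 N3).sub ((differentiableOn_E2.add F2).sub F4))
    ((hL F4 N4).sub ((differentiableOn_E2.sub F2).sub F3))
    (fun z _ ↦ by
      simp only [theta3_add_one, theta4_add_one, E2_add_one]
      rw [logDeriv_add_one_of_eq_mul (g := fun z ↦ theta2 z ^ 4) (-1) (by norm_num)
        fun z ↦ by rw [theta2_pow_four_add_one, neg_one_mul]]
      ring)
    (fun z _ ↦ by
      simp only [theta2_pow_four_add_one, theta4_add_one, E2_add_one]
      rw [logDeriv_add_one_of_eq_mul (g := fun z ↦ theta4 z ^ 4) 1 one_ne_zero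
        fun z ↦ by rw [theta3_add_one, one_mul]]
      ring)
    (fun z _ ↦ by
      simp only [theta2_pow_four_add_one, theta3_add_one, E2_add_one]
      rw [logDeriv_add_one_of_eq_mul (g := fun z ↦ theta3 z ^ 4) 1 one_ne_zero
        fun z ↦ by rw [theta4_add_one, one_mul]]
      ring)
    (fun z hz ↦ by
      simp only [theta3_pow_four_neg_one_div hz, theta4_pow_four_neg_one_div hz,
        E2_neg_one_div hz]
      rw [logDeriv_neg_one_div_of_weight_two F2 F4 N4
        (fun z hz ↦ theta2_pow_four_neg_one_div hz) hz]
      ring)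
    (fun z hz ↦ by
      simp only [theta2_pow_four_neg_one_div hz, theta4_pow_four_neg_one_div hz,
        E2_neg_one_div hz]
      rw [logDeriv_neg_one_div_of_weight_two F3 F3 N3
        (fun z hz ↦ theta3_pow_four_neg_one_div hz) hz]
      ring)
    (fun z hz ↦ by
      simp only [theta2_pow_four_neg_one_div hz, theta3_pow_four_neg_one_div hz,
        E2_neg_one_div hz]
      rw [logDeriv_neg_one_div_of_weight_two F4 F2 N2
        (fun z hz ↦ theta4_pow_four_neg_one_div hz) hz]
      ring)
    (by
      have := (tendsto_logDeriv_theta2_pow_four.const_mul (3 / (Real.pi * I))).sub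
        ((tendsto_E2.add (tendsto_theta3.pow 4)).add (tendsto_theta4.pow 4))
      rw [div_mul_cancel₀ _ (mul_ne_zero hpi I_ne_zero)] at this
      norm_num at this
      exact this)
    (by
      have := ((tendsto_logDeriv_comap_im_atTop (by norm_num) F3
        (tendsto_theta3.pow 4)).const_mul (3 / (Real.pi * I))).sub
        ((tendsto_E2.add tendsto_theta2_pow_four).sub (tendsto_theta4.pow 4))
      norm_num at this
      exact this)
    (by
      have := ((tendsto_logDeriv_comap_im_atTop (by norm_num) F4
        (tendsto_theta4.pow 4)).const_mul (3 / (Real.pi * I))).sub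
        ((tendsto_E2.sub tendsto_theta2_pow_four).sub (tendsto_theta3.pow 4))
      norm_num at this
      exact this) hz
  exact ⟨sub_eq_zero.mp h.1, sub_eq_zero.mp h.2.1, sub_eq_zero.mp h.2.2⟩

lemma hasDerivAt_theta_of_logDeriv {f : ℂ → ℂ} {z r : ℂ} (hf : DifferentiableAt ℂ f z)
    (hf0 : f z ≠ 0) (h : 3 / (Real.pi * I) * logDeriv (fun z ↦ f z ^ 4) z = r) :
    HasDerivAt f (2 * Real.pi * I * (f z * r / 24)) z := by
  have hpi : (Real.pi : ℂ) ≠ 0 := by exact_mod_cast Real.pi_ne_zero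
  convert! hf.hasDerivAt using 1
  rw [← h, logDeriv_apply, (hf.hasDerivAt.fun_pow 4).deriv]
  have := I_ne_zero
  field_simp
  push_cast
  ring

end

theorem ramanujan_identities_Gamma0_two (τ : ℂ) (hτ : 0 < τ.im) :
    (1 / (2 * Real.pi * Complex.I)) * deriv A2sq τ =
      (1 / 4) * (A2sq τ * E2quasi τ + C2sq τ ^ 2 - B2form τ ^ 4) ∧
    (1 / (2 * Real.pi * Complex.I)) * deriv B2form τ =
      (1 / 8) * B2form τ * (E2quasi τ - A2sq τ) ∧
    (1 / (2 * Real.pi * Complex.I)) * deriv C2sq τ =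
      (1 / 4) * C2sq τ * (E2quasi τ + A2sq τ) ∧
    (1 / (2 * Real.pi * Complex.I)) * deriv E2quasi τ =
      (1 / 8) * (E2quasi τ ^ 2 - A2sq τ ^ 2) := by
  have hp : (2 * Real.pi * Complex.I : ℂ) ≠ 0 := by simp [Real.pi_ne_zero]
  have hn := UpperHalfPlane.isOpen_upperHalfPlaneSet.mem_nhds hτ
  obtain ⟨h2, h3, h4⟩ := logDeriv_theta_pow_four hτ
  have d2 := hasDerivAt_theta_of_logDeriv (differentiableOn_theta2.differentiableAt hn)
    (theta2_ne_zero hτ) h2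
  have d3 := hasDerivAt_theta_of_logDeriv (differentiableOn_theta3.differentiableAt hn)
    (theta3_ne_zero hτ) h3
  have d4 := hasDerivAt_theta_of_logDeriv (differentiableOn_theta4.differentiableAt hn)
    (theta4_ne_zero hτ) h4
  have hJ := theta3_pow_four_eq hτ
  have dA : HasDerivAt A2sq _ τ := ((d3.fun_pow 4).add (d4.fun_pow 4)).const_mul (1 / 2)
  have dB : HasDerivAt B2form _ τ := d3.mul d4
  have dC : HasDerivAt C2sq _ τ := (d2.fun_pow 4).const_mul (1 / 2)
  have hE (w : ℂ) (hw : 0 < w.im) : E2quasi w = (A2sq w + 2 * E2 w) / 3 := by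
    rw [E2quasi, A2sq, E2_two_mul_eq hw]
    ring
  have dE := ((dA.add ((differentiableOn_E2.differentiableAt hn).hasDerivAt.const_mul 2)).div_const
    3).congr_of_eventuallyEq ((eventually_im_pos hτ).mono hE)
  have hE2 : deriv E2 τ = 2 * Real.pi * Complex.I *
      ((E2 τ ^ 2 - (theta2 τ ^ 8 + theta3 τ ^ 8 + theta4 τ ^ 8) / 2) / 12) := by
    rw [← deriv_E2_eq hτ]
    have := Complex.I_ne_zero
    have hpi : (Real.pi : ℂ) ≠ 0 := by exact_mod_cast Real.pi_ne_zero
    field_simp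
    ring
  have hdiv {x y : ℂ} (h : x = y * (2 * Real.pi * Complex.I)) :
      1 / (2 * Real.pi * Complex.I) * x = y := by
    rw [one_div_mul_eq_div, div_eq_iff hp, h]
  rw [dA.deriv, dB.deriv, dC.deriv, dE.deriv, hE2, hE τ hτ]
  simp only [A2sq, B2form, C2sq]
  push_cast
  refine ⟨hdiv ?_, hdiv ?_, hdiv ?_, hdiv ?_⟩
  · linear_combination (-(2 * Real.pi * Complex.I) * ((theta3 τ ^ 4 - theta4 τ ^ 4) / 12 -
      (theta2 τ ^ 4 + theta3 τ ^ 4 - theta4 τ ^ 4) / 16)) * hJ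
  · ring
  · ring
  · linear_combination (2 * Real.pi * Complex.I * theta2 τ ^ 4 / 36) * hJ
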